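/- arXiv:math/0505584 — 2 statements merged into one kernel-verified Lean document; each statement's English description precedes it below -/
import Mathlib

section
/- Let N be a positive integer, let α > 1 be a real number, let c₁ > 0 and c₂, c₃ ≥ 0 be real constants, and let φ : ℝ^N → ℝ be a twice continuously differentiable nonnegative function satisfying Δφ(x) ≥ c₁·φ(x)^α − c₂·φ(x) − c₃ for every x ∈ ℝ^N. Then φ(x) ≤ max(1, ((c₂+c₃)/c₁)^(1/(α−1))) for every x ∈ ℝ^N. -/
/-- The Euclidean Laplacian of a function `φ : ℝ^N → ℝ`:
`Δφ(x) = ∑ i, ∂²φ/∂x_i²(x)`. -/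
noncomputable def euclideanLaplacian {N : ℕ} (φ : EuclideanSpace ℝ (Fin N) → ℝ)
    (x : EuclideanSpace ℝ (Fin N)) : ℝ :=
  ∑ i : Fin N, iteratedFDeriv ℝ 2 φ x ![EuclideanSpace.single i 1, EuclideanSpace.single i 1]

open Filter Topology in
/-- Second-order necessary condition for a local maximum of a function of one real variable. -/
theorem IsLocalMax.second_deriv_nonpos {g g' : ℝ → ℝ} {g'' x : ℝ} (hmax : IsLocalMax g x)
    (hg : ∀ᶠ t in 𝓝 x, HasDerivAt g (g' t) t) (hg' : HasDerivAt g' g'' x) : g'' ≤ 0 := by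
  by_contra! hpos
  have hderiv : deriv g =ᶠ[𝓝 x] g' := hg.mono fun t ht => ht.deriv
  have hdd : deriv (deriv g) x = g'' := by rw [hderiv.deriv_eq, hg'.deriv]
  have hmin : IsLocalMin g x :=
    isLocalMin_of_deriv_deriv_pos (hdd ▸ hpos) hmax.deriv_eq_zero hg.self_of_nhds.continuousAt
  have hconst : g =ᶠ[𝓝 x] fun _ => g x := by
    filter_upwards [hmax, hmin] with t h₁ h₂ using le_antisymm h₁ h₂
  have hzero : deriv (deriv g) x = 0 := by
    rw [hconst.deriv.deriv_eq]
    simp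
  linarith

section Line

variable {E : Type*} [NormedAddCommGroup E] [NormedSpace ℝ E] {φ : E → ℝ}

theorem hasDerivAt_comp_line (hφ : ContDiff ℝ 2 φ) (x e : E) (t : ℝ) :
    HasDerivAt (fun t : ℝ => φ (x + t • e)) (fderiv ℝ φ (x + t • e) e) t := by
  have hline : HasDerivAt (fun t : ℝ => x + t • e) e t := by
    simpa using ((hasDerivAt_id t).smul_const e).const_add x
  exact ((hφ.differentiable (by norm_num)) (x + t • e)).hasFDerivAt.comp_hasDerivAt t hline

theorem hasDerivAt_fderiv_comp_line (hφ : ContDiff ℝ 2 φ) (x e : E) :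
    HasDerivAt (fun t : ℝ => fderiv ℝ φ (x + t • e) e) (iteratedFDeriv ℝ 2 φ x ![e, e]) 0 := by
  have hline : HasDerivAt (fun t : ℝ => x + t • e) e 0 := by
    simpa using ((hasDerivAt_id (0 : ℝ)).smul_const e).const_add x
  have hd : Differentiable ℝ (fderiv ℝ φ) :=
    (hφ.fderiv_right (m := 1) (by norm_num)).differentiable (by norm_num)
  have h := (hd (x + (0 : ℝ) • e)).hasFDerivAt.comp_hasDerivAt (0 : ℝ) hline
  have h' := h.clm_apply (hasDerivAt_const (0 : ℝ) e)
  simpa [iteratedFDeriv_two_apply] using h'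

end Line

/-- The derivative of `t ↦ (D / (s - 2pt - t²)) ^ (m + 1)`. -/
theorem hasDerivAt_div_quadratic_pow {D s p t : ℝ} (hD : D ≠ 0)
    (hs : s - 2 * p * t - t ^ 2 ≠ 0) (m : ℕ) :
    HasDerivAt (fun t : ℝ => (D / (s - 2 * p * t - t ^ 2)) ^ (m + 1))
      ((m + 1) / D * ((D / (s - 2 * p * t - t ^ 2)) ^ (m + 2) * (2 * p + 2 * t))) t := by
  have h₁ : HasDerivAt (fun t : ℝ => s - 2 * p * t - t ^ 2) (-(2 * p) - 2 * t) t := by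
    have h := (((hasDerivAt_id t).const_mul (2 * p)).const_sub s).sub ((hasDerivAt_id t).pow 2)
    exact h.congr_deriv (by simp)
  have h₂ := ((hasDerivAt_const t D).div h₁ hs).pow (m + 1)
  refine h₂.congr_deriv ?_
  simp only [Nat.add_sub_cancel, Pi.div_apply]
  push_cast
  rw [pow_add _ m 2]
  field_simp
  ring

/-- The second derivative at `0` of `t ↦ (D / (s - 2pt - t²)) ^ (m + 1)`. -/
theorem hasDerivAt_deriv_div_quadratic_pow {D s p : ℝ} (hD : D ≠ 0) (hs : s ≠ 0) (m : ℕ) :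
    HasDerivAt
      (fun t : ℝ =>
        (m + 1) / D * ((D / (s - 2 * p * t - t ^ 2)) ^ (m + 2) * (2 * p + 2 * t)))
      ((m + 1) / D ^ 2 * ((D / s) ^ (m + 3) * ((m + 2) * (2 * p) ^ 2 + 2 * s))) 0 := by
  have h₁ := hasDerivAt_div_quadratic_pow (p := p) (t := 0) hD (by simpa using hs) (m + 1)
  have h₂ : HasDerivAt (fun t : ℝ => 2 * p + 2 * t) 2 0 := by
    simpa using ((hasDerivAt_id (0 : ℝ)).const_mul 2).const_add (2 * p)
  have h₃ := (h₁.mul h₂).const_mul ((m + 1 : ℝ) / D)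
  refine h₃.congr_deriv ?_
  simp only [mul_zero, sub_zero, ne_eq, OfNat.ofNat_ne_zero, not_false_eq_true, zero_pow, add_zero]
  push_cast
  have h₄ : (D / s) ^ (m + 3) * s = (D / s) ^ (m + 2) * D := by
    rw [pow_succ (D / s) (m + 2)]; field_simp
  rw [show m + 1 + 2 = m + 3 from rfl, show m + 1 + 1 = m + 2 from rfl]
  generalize (D / s) ^ (m + 3) = u, (D / s) ^ (m + 2) = v at h₄ ⊢
  field_simp
  linear_combination -h₄

open Filter Topology in
/-- At a local maximum of `φ` minus the barrier `(D / (R² - ‖· - x₀‖²)) ^ (m + 1)`, the second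
derivative of `φ` in any unit direction is controlled by the barrier. -/
theorem iteratedFDeriv_two_le_of_isLocalMax_sub_barrier {E : Type*} [NormedAddCommGroup E]
    [InnerProductSpace ℝ E] {φ : E → ℝ} (hφ : ContDiff ℝ 2 φ) {x₀ x e : E} (he : ‖e‖ = 1)
    {D R : ℝ} (hD : 0 < D) (hs : 0 < R ^ 2 - ‖x - x₀‖ ^ 2) (m : ℕ)
    (hmax : IsLocalMax (fun y => φ y - (D / (R ^ 2 - ‖y - x₀‖ ^ 2)) ^ (m + 1)) x) :
    iteratedFDeriv ℝ 2 φ x ![e, e] ≤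
      (m + 1) * (4 * m + 10) * R ^ 2 / D ^ 2 * (D / (R ^ 2 - ‖x - x₀‖ ^ 2)) ^ (m + 3) := by
  set s := R ^ 2 - ‖x - x₀‖ ^ 2 with hs_def
  set p := inner ℝ (x - x₀) e with hp_def
  have hquad (t : ℝ) : R ^ 2 - ‖x + t • e - x₀‖ ^ 2 = s - 2 * p * t - t ^ 2 := by
    rw [show x + t • e - x₀ = (x - x₀) + t • e by abel, norm_add_sq_real, inner_smul_right,
      norm_smul, he, mul_one, Real.norm_eq_abs, sq_abs, hs_def, hp_def]
    ring
  have hcont : ContinuousAt (fun t : ℝ => x + t • e) 0 := by fun_prop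
  have hmax' : IsLocalMax
      (fun t : ℝ => φ (x + t • e) - (D / (s - 2 * p * t - t ^ 2)) ^ (m + 1)) 0 := by
    have hx : x + (0 : ℝ) • e = x := by simp
    have h := IsLocalMax.comp_continuous (b := (0 : ℝ)) (g := fun t : ℝ => x + t • e)
      (by simpa only [hx] using hmax) hcont
    simpa only [Function.comp_def, hquad] using h
  have hne : ∀ᶠ t : ℝ in 𝓝 0, s - 2 * p * t - t ^ 2 ≠ 0 := by
    have hc : ContinuousAt (fun t : ℝ => s - 2 * p * t - t ^ 2) 0 := by fun_prop
    exact hc.eventually_ne (by simpa using hs.ne')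
  have hkey := hmax'.second_deriv_nonpos
    (hne.mono fun t ht =>
      (hasDerivAt_comp_line hφ x e t).sub (hasDerivAt_div_quadratic_pow hD.ne' ht m))
    ((hasDerivAt_fderiv_comp_line hφ x e).sub
      (hasDerivAt_deriv_div_quadratic_pow hD.ne' hs.ne' m))
  have hp : p ^ 2 ≤ R ^ 2 := by
    have h := abs_real_inner_le_norm (x - x₀) e
    rw [he, mul_one] at h
    have h' := sq_le_sq' (abs_le.mp h).1 (abs_le.mp h).2
    linarith
  have hsR : s ≤ R ^ 2 := by nlinarith [sq_nonneg ‖x - x₀‖]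
  have hb : 0 ≤ (D / s) ^ (m + 3) := by positivity
  have hfac : (m + 2 : ℝ) * (2 * p) ^ 2 + 2 * s ≤ (4 * m + 10) * R ^ 2 := by
    nlinarith [mul_le_mul_of_nonneg_left hp (by positivity : (0 : ℝ) ≤ 4 * (m + 2))]
  calc iteratedFDeriv ℝ 2 φ x ![e, e]
      ≤ (m + 1) / D ^ 2 * ((D / s) ^ (m + 3) * ((m + 2) * (2 * p) ^ 2 + 2 * s)) := by linarith
    _ ≤ (m + 1) / D ^ 2 * ((D / s) ^ (m + 3) * ((4 * m + 10) * R ^ 2)) := by gcongr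
    _ = _ := by ring

/-- If a continuous function exceeds, at the center of a ball, a barrier blowing up on the boundary,
then the difference has a positive local maximum inside the ball. -/
theorem exists_isLocalMax_sub_barrier {E : Type*} [NormedAddCommGroup E] [ProperSpace E]
    {φ : E → ℝ} (hφ : Continuous φ) (x₀ : E) {a D R : ℝ} (ha : 0 < a) (hD : 0 < D) (hR : 0 < R)
    (m : ℕ) (h₀ : a + (D / R ^ 2) ^ (m + 1) < φ x₀) :
    ∃ x, 0 < R ^ 2 - ‖x - x₀‖ ^ 2 ∧ a + (D / (R ^ 2 - ‖x - x₀‖ ^ 2)) ^ (m + 1) < φ x ∧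
      IsLocalMax (fun y => φ y - (D / (R ^ 2 - ‖y - x₀‖ ^ 2)) ^ (m + 1)) x := by
  obtain ⟨M, hM⟩ := (isCompact_closedBall x₀ R).bddAbove_image hφ.continuousOn
  have hM' (x : E) (hx : 0 ≤ R ^ 2 - ‖x - x₀‖ ^ 2) : φ x ≤ M := by
    refine hM ⟨x, ?_, rfl⟩
    rw [mem_closedBall_iff_norm]
    exact (sq_le_sq₀ (norm_nonneg _) hR.le).mp (by linarith)
  set L := max 1 M
  have hL : 0 < L := lt_max_of_lt_left one_pos
  set r := min (R ^ 2) (D / L)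
  have hr : 0 < r := lt_min (by positivity) (by positivity)
  have hLr : L ≤ D / r := by
    rw [le_div_iff₀ hr, mul_comm, ← le_div_iff₀ hL]
    exact min_le_right _ _
  have hcs : Continuous fun x : E => R ^ 2 - ‖x - x₀‖ ^ 2 := by fun_prop
  set K := {x : E | r ≤ R ^ 2 - ‖x - x₀‖ ^ 2} with hK_def
  have hK : IsCompact K := by
    refine (isCompact_closedBall x₀ R).of_isClosed_subset (isClosed_le continuous_const hcs) ?_
    intro x hx
    have hx' : r ≤ R ^ 2 - ‖x - x₀‖ ^ 2 := hx
    rw [mem_closedBall_iff_norm]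
    exact (sq_le_sq₀ (norm_nonneg _) hR.le).mp (by linarith)
  have hx₀ : x₀ ∈ K := by simp [hK_def, r]
  obtain ⟨x, hxK, hx⟩ := hK.exists_isMaxOn ⟨x₀, hx₀⟩
    (f := fun y => φ y - (D / (R ^ 2 - ‖y - x₀‖ ^ 2)) ^ (m + 1)) (by
      refine hφ.continuousOn.sub (ContinuousOn.pow
        (continuousOn_const.div hcs.continuousOn fun y hy => ?_) _)
      exact (hr.trans_le hy).ne')
  have hsx : r ≤ R ^ 2 - ‖x - x₀‖ ^ 2 := hxK
  have hval : a + (D / (R ^ 2 - ‖x - x₀‖ ^ 2)) ^ (m + 1) < φ x := by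
    have h := isMaxOn_iff.mp hx x₀ hx₀
    simp only [sub_self, norm_zero, ne_eq, OfNat.ofNat_ne_zero, not_false_eq_true, zero_pow,
      sub_zero] at h
    linarith
  have hlt : r < R ^ 2 - ‖x - x₀‖ ^ 2 := by
    refine lt_of_le_of_ne hsx fun heq => ?_
    rw [← heq] at hval
    have h₁ : D / r ≤ (D / r) ^ (m + 1) :=
      le_self_pow₀ ((le_max_left _ _).trans hLr) (Nat.succ_ne_zero m)
    have h₂ := hM' x (hr.le.trans hsx)
    have h₃ : M ≤ L := le_max_right _ _
    linarith
  refine ⟨x, hr.trans hlt, hval, hx.isLocalMax ?_⟩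
  exact Filter.mem_of_superset ((isOpen_lt continuous_const hcs).mem_nhds hlt)
    fun y (hy : r < R ^ 2 - ‖y - x₀‖ ^ 2) => hy.le

/-- Above any level `a` larger than the threshold, the nonlinearity `c₁ t ^ α - c₂ t - c₃`
dominates a multiple of `t ^ α`. -/
theorem exists_pos_mul_rpow_le {α c₁ c₂ c₃ a : ℝ} (hα : 1 < α) (hc₁ : 0 < c₁) (hc₂ : 0 ≤ c₂)
    (hc₃ : 0 ≤ c₃) (ha : 1 ≤ a) (hlt : ((c₂ + c₃) / c₁) ^ (1 / (α - 1)) < a) :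
    ∃ c > 0, ∀ t, a ≤ t → c * (t * t ^ (α - 1)) ≤ c₁ * t ^ α - c₂ * t - c₃ := by
  have hα' : 0 < α - 1 := by linarith
  have hq : (c₂ + c₃) / c₁ < a ^ (α - 1) := by
    have h := Real.rpow_lt_rpow (by positivity) hlt hα'
    rwa [← Real.rpow_mul (by positivity), one_div_mul_cancel hα'.ne', Real.rpow_one] at h
  rw [div_lt_iff₀ hc₁] at hq
  have hpos : 0 < a ^ (α - 1) := Real.rpow_pos_of_pos (by linarith) _
  refine ⟨c₁ - (c₂ + c₃) / a ^ (α - 1), ?_, fun t ht => ?_⟩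
  · rw [gt_iff_lt, sub_pos, div_lt_iff₀ hpos]
    linarith
  have ht₀ : 0 < t := by linarith
  have hmono : a ^ (α - 1) ≤ t ^ (α - 1) := Real.rpow_le_rpow (by linarith) ht hα'.le
  have hS : c₂ + c₃ ≤ (c₂ + c₃) / a ^ (α - 1) * t ^ (α - 1) := by
    rw [div_mul_eq_mul_div, le_div_iff₀ hpos]
    gcongr
  have hsplit : t ^ α = t * t ^ (α - 1) := by
    rw [Real.rpow_sub_one ht₀.ne']
    field_simp
  rw [hsplit]
  nlinarith [mul_le_mul_of_nonneg_left hS ht₀.le,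
    mul_le_mul_of_nonneg_left (ha.trans ht) hc₃]

theorem pow_add_two_le_mul_rpow {b t β : ℝ} {m : ℕ} (hb : 0 ≤ b) (ht : 1 ≤ t)
    (hbt : b ^ (m + 1) ≤ t) (hβ : 2 ≤ β * (m + 1)) : b ^ (m + 3) ≤ t * t ^ β := by
  have hm : (0 : ℝ) < m + 1 := by positivity
  have h : b ^ 2 ≤ t ^ β :=
    calc b ^ 2 = (b ^ (m + 1)) ^ (2 / (m + 1 : ℝ)) := by
          rw [← Real.rpow_natCast b (m + 1), ← Real.rpow_mul hb, ← Real.rpow_natCast b 2]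
          congr 1
          push_cast
          field_simp
      _ ≤ t ^ (2 / (m + 1 : ℝ)) := Real.rpow_le_rpow (by positivity) hbt (by positivity)
      _ ≤ t ^ β := Real.rpow_le_rpow_of_exponent_le ht (by rwa [div_le_iff₀ hm])
  calc b ^ (m + 3) = b ^ (m + 1) * b ^ 2 := by ring
    _ ≤ t * t ^ β := by gcongr

/-- Maximum principle (Euclidean case of Proposition 2.2): if `φ ≥ 0` is `C²` and
`Δφ ≥ c₁ φ^α − c₂ φ − c₃` with `α > 1`, `c₁ > 0`, `c₂, c₃ ≥ 0`, then
`φ ≤ max(1, ((c₂+c₃)/c₁)^(1/(α−1)))`. -/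
theorem stmt_0 {N : ℕ} (hN : 0 < N) {α c₁ c₂ c₃ : ℝ}
    (hα : 1 < α) (hc₁ : 0 < c₁) (hc₂ : 0 ≤ c₂) (hc₃ : 0 ≤ c₃)
    (φ : EuclideanSpace ℝ (Fin N) → ℝ) (hφ : ContDiff ℝ 2 φ)
    (hφ0 : ∀ x, 0 ≤ φ x)
    (hineq : ∀ x, c₁ * φ x ^ α - c₂ * φ x - c₃ ≤ euclideanLaplacian φ x) :
    ∀ x, φ x ≤ max 1 (((c₂ + c₃) / c₁) ^ (1 / (α - 1))) := by
  intro x₀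
  by_contra! hx₀
  obtain ⟨a, hMa, hax₀⟩ := exists_between hx₀
  obtain ⟨h1a, hqa⟩ := max_lt_iff.mp hMa
  obtain ⟨c, hc, hgrowth⟩ := exists_pos_mul_rpow_le hα hc₁ hc₂ hc₃ h1a.le hqa
  have hα' : 0 < α - 1 := by linarith
  obtain ⟨m, hm⟩ := exists_nat_ge (2 / (α - 1))
  have hβ : 2 ≤ (α - 1) * (m + 1) := by
    rw [div_le_iff₀ hα'] at hm
    nlinarith
  set C : ℝ := N * ((m + 1) * (4 * m + 10)) with hC_def
  obtain ⟨l, hl, hCl⟩ : ∃ l : ℝ, 0 < l ∧ C < c * l ^ 2 := by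
    have hC : 0 ≤ C := by positivity
    refine ⟨C / c + 1, by positivity, ?_⟩
    have h : c * (C / c + 1) = C + c := by field_simp
    have h' : 0 ≤ C / c := by positivity
    nlinarith
  obtain ⟨ε, hε, hε1, hεφ⟩ : ∃ ε : ℝ, 0 < ε ∧ ε ≤ 1 ∧ a + ε < φ x₀ :=
    ⟨min 1 ((φ x₀ - a) / 2), lt_min one_pos (by linarith), min_le_left _ _, by
      linarith [min_le_right 1 ((φ x₀ - a) / 2)]⟩
  set R := l / ε with hR_def
  have hR : 0 < R := by positivity
  obtain ⟨x, hs, hval, hmax⟩ := exists_isLocalMax_sub_barrier hφ.continuous x₀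
    (a := a) (D := l * R) (by linarith) (by positivity) hR m (by
      have h : l * R / R ^ 2 = ε := by
        rw [hR_def]; field_simp
      rw [h]
      have h' := pow_le_of_le_one hε.le hε1 (Nat.succ_ne_zero m)
      simp only [Nat.succ_eq_add_one] at h'
      linarith)
  set b := l * R / (R ^ 2 - ‖x - x₀‖ ^ 2) with hb_def
  have hb : 0 < b := by positivity
  have hbm : 0 < b ^ (m + 1) := by positivity
  have hlower : c * b ^ (m + 3) ≤ euclideanLaplacian φ x :=
    calc c * b ^ (m + 3) ≤ c * (φ x * φ x ^ (α - 1)) := by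
          gcongr
          exact pow_add_two_le_mul_rpow hb.le (by linarith) (by linarith) hβ
      _ ≤ _ := (hgrowth _ (by linarith)).trans (hineq x)
  have hupper : euclideanLaplacian φ x ≤ C * R ^ 2 / (l * R) ^ 2 * b ^ (m + 3) := by
    have h : euclideanLaplacian φ x ≤ ∑ _i : Fin N,
        (m + 1) * (4 * m + 10) * R ^ 2 / (l * R) ^ 2 * b ^ (m + 3) :=
      Finset.sum_le_sum fun i _ => iteratedFDeriv_two_le_of_isLocalMax_sub_barrier hφ
        (by simp) (by positivity) hs m hmax
    rw [Finset.sum_const, Finset.card_univ, Fintype.card_fin, nsmul_eq_mul] at h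
    refine h.trans_eq ?_
    rw [hC_def]
    ring
  have hcC : c ≤ C * R ^ 2 / (l * R) ^ 2 :=
    le_of_mul_le_mul_right (hlower.trans hupper) (by positivity)
  rw [mul_pow, mul_div_mul_right _ _ (by positivity), le_div_iff₀ (by positivity)] at hcC
  linarith
end

section
/- Let n be a positive integer. Define u : ℂⁿ → ℂ by u(z) = −√−1 + (√−1/2)·Σ_{k=1}^n z_k². Then the Bryant–Griffiths period vector (1, z₁/√2, …, zₙ/√2, u(z) − (1/2)·Σ_{i=1}^n z_i·∂u/∂z_i(z), (∂u/∂z₁)(z)/√2, …, (∂u/∂zₙ)(z)/√2) ∈ ℂ^{2n+2} equals Ω(z) = e₁ − √−1·e_{n+2} + Σ_{k=1}^n (z_k/√2)·(e_{k+1} + √−1·e_{n+2+k}) for every z ∈ ℂⁿ. In particular Ω is an affine function of z, all its partial derivatives of order at least two vanish, and therefore the Yukawa coupling F_{ijk}(z) = Q₀(∂_i∂_j∂_k Ω(z), Ω(z)) vanishes identically for all indices i, j, k and all z ∈ ℂⁿ. -/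
/-- The standard basis vector `e_i` of `ℂ^{2n+2}` (0-indexed). -/
noncomputable def eVec (n : ℕ) (i : Fin (2 * n + 2)) : Fin (2 * n + 2) → ℂ :=
  Pi.single i 1

/-- The skew-symmetric bilinear form
`Q₀(x, y) = ∑_{k=1}^{n+1} (x_k y_{n+1+k} − x_{n+1+k} y_k)` on `ℂ^{2n+2}`. -/
noncomputable def Q0 (n : ℕ) (x y : Fin (2 * n + 2) → ℂ) : ℂ :=
  ∑ k : Fin (n + 1),
    (x ⟨(k : ℕ), by have := k.isLt; omega⟩ * y ⟨n + 1 + (k : ℕ), by have := k.isLt; omega⟩ -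
      x ⟨n + 1 + (k : ℕ), by have := k.isLt; omega⟩ * y ⟨(k : ℕ), by have := k.isLt; omega⟩)

/-- `Ω(z) = e₁ − i·e_{n+2} + ∑_k (z_k/√2)·(e_{k+1} + i·e_{n+2+k})` (1-indexed basis). -/
noncomputable def OmegaVec (n : ℕ) (z : Fin n → ℂ) : Fin (2 * n + 2) → ℂ :=
  eVec n ⟨0, by omega⟩ - Complex.I • eVec n ⟨n + 1, by omega⟩ +
    ∑ k : Fin n, (z k / (Real.sqrt 2 : ℂ)) •
      (eVec n ⟨(k : ℕ) + 1, by have := k.isLt; omega⟩ +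
        Complex.I • eVec n ⟨n + 2 + (k : ℕ), by have := k.isLt; omega⟩)

/-- The function `u(z) = −i + (i/2)·∑_k z_k²` of the example in §3. -/
noncomputable def uFun (n : ℕ) (z : Fin n → ℂ) : ℂ :=
  -Complex.I + (Complex.I / 2) * ∑ k, z k ^ 2

/-- The partial derivative `∂u/∂z_i(z)`. -/
noncomputable def du (n : ℕ) (z : Fin n → ℂ) (i : Fin n) : ℂ :=
  fderiv ℂ (uFun n) z (Pi.single i 1)

/-- The Bryant–Griffiths period vector
`(1, z₁/√2, …, zₙ/√2, u − (1/2)∑ zᵢuᵢ, u₁/√2, …, uₙ/√2)`. -/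
noncomputable def periodVec (n : ℕ) (z : Fin n → ℂ) : Fin (2 * n + 2) → ℂ :=
  eVec n ⟨0, by omega⟩ +
    (∑ k : Fin n, (z k / (Real.sqrt 2 : ℂ)) •
      eVec n ⟨(k : ℕ) + 1, by have := k.isLt; omega⟩) +
    (uFun n z - (1 / 2) * ∑ i, z i * du n z i) • eVec n ⟨n + 1, by omega⟩ +
    ∑ k : Fin n, (du n z k / (Real.sqrt 2 : ℂ)) •
      eVec n ⟨n + 2 + (k : ℕ), by have := k.isLt; omega⟩

theorem du_eq (n : ℕ) (z : Fin n → ℂ) (i : Fin n) : du n z i = Complex.I * z i := by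
  have h : HasFDerivAt (uFun n) ((Complex.I / 2) • ∑ k : Fin n, (2 * z k) •
      (ContinuousLinearMap.proj k : (Fin n → ℂ) →L[ℂ] ℂ)) z := by
    refine HasFDerivAt.const_add _ (HasFDerivAt.const_mul (HasFDerivAt.fun_sum fun k _ => ?_) _)
    simpa using (hasFDerivAt_apply (𝕜 := ℂ) k z).pow 2
  rw [du, h.fderiv]
  simp [Pi.single_apply]
  ring

theorem periodVec_eq_omegaVec (n : ℕ) (z : Fin n → ℂ) : periodVec n z = OmegaVec n z := by
  have h : uFun n z - (1 / 2) * ∑ i, z i * du n z i = -Complex.I := by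
    have hs : ∑ i, z i * du n z i = Complex.I * ∑ i, z i ^ 2 := by
      rw [Finset.mul_sum]
      exact Finset.sum_congr rfl fun i _ => by rw [du_eq]; ring
    rw [hs, uFun]
    ring
  have hk (k : Fin n) :
      du n z k / (Real.sqrt 2 : ℂ) = (z k / (Real.sqrt 2 : ℂ)) * Complex.I := by
    rw [du_eq]; ring
  simp only [periodVec, OmegaVec, h, hk, smul_add, Finset.sum_add_distrib, mul_smul, neg_smul]
  abel

theorem iteratedFDeriv_const_add_clm_eq_zero {𝕜 E F : Type*} [NontriviallyNormedField 𝕜]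
    [NormedAddCommGroup E] [NormedSpace 𝕜 E] [NormedAddCommGroup F] [NormedSpace 𝕜 F]
    (c : F) (L : E →L[𝕜] F) (x : E) {m : ℕ} (hm : 2 ≤ m) :
    iteratedFDeriv 𝕜 m (fun y => c + L y) x = 0 := by
  obtain ⟨m, rfl⟩ := Nat.exists_eq_add_of_le' (one_le_two.trans hm)
  have h : fderiv 𝕜 (fun y => c + L y) = fun _ => L :=
    funext fun y => (L.hasFDerivAt.const_add c).fderiv
  rw [iteratedFDeriv_succ_eq_comp_right, h, Function.comp_apply,
    iteratedFDeriv_const_of_ne (by omega), Pi.zero_apply, LinearIsometryEquiv.map_zero]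

theorem iteratedFDeriv_omegaVec_eq_zero (n : ℕ) (z : Fin n → ℂ) {m : ℕ} (hm : 2 ≤ m) :
    iteratedFDeriv ℂ m (OmegaVec n) z = 0 := by
  have h : OmegaVec n = fun y => (eVec n ⟨0, by omega⟩ - Complex.I • eVec n ⟨n + 1, by omega⟩) +
      (∑ k : Fin n, ((Real.sqrt 2 : ℂ)⁻¹ •
        (ContinuousLinearMap.proj k : (Fin n → ℂ) →L[ℂ] ℂ)).smulRight
          (eVec n ⟨(k : ℕ) + 1, by omega⟩ +
            Complex.I • eVec n ⟨n + 2 + (k : ℕ), by omega⟩)) y := by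
    funext y
    simp [OmegaVec, div_eq_inv_mul]
  rw [h]
  exact iteratedFDeriv_const_add_clm_eq_zero _ _ z hm

/-- For `u(z) = −i + (i/2)∑ z_k²`, the Bryant–Griffiths period vector equals `Ω(z)`;
in particular all partial derivatives of `Ω` of order at least two vanish, and the
Yukawa coupling `F_{ijk}(z) = Q₀(∂_i∂_j∂_k Ω(z), Ω(z))` vanishes identically. -/
theorem stmt_6 (n : ℕ) (hn : 0 < n) :
    (∀ z : Fin n → ℂ, periodVec n z = OmegaVec n z) ∧
    (∀ (z : Fin n → ℂ) (m : ℕ), 2 ≤ m → iteratedFDeriv ℂ m (OmegaVec n) z = 0) ∧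
    (∀ (z : Fin n → ℂ) (i j k : Fin n),
      Q0 n (iteratedFDeriv ℂ 3 (OmegaVec n) z
        ![Pi.single i 1, Pi.single j 1, Pi.single k 1]) (OmegaVec n z) = 0) := by
  refine ⟨periodVec_eq_omegaVec n, fun z m hm => iteratedFDeriv_omegaVec_eq_zero n z hm,
    fun z i j k => ?_⟩
  rw [iteratedFDeriv_omegaVec_eq_zero n z (by norm_num)]
  simp [Q0]
end
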